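/- arXiv:2010.05217 — 3 statements merged into one kernel-verified Lean document; each statement's English description precedes it below -/
import Mathlib

section
/- Assume the GBDT data with H(x) = β(x)*β(x), where β : [0,∞) → ℂ^{p×2p} is continuously differentiable and satisfies β(x) j β(x)* = 0 for all x. Assume S(x) is invertible for all x ≥ 0 and 𝒜 is invertible, and set β̃(x) = β(x) w_𝒜(x,0). Then for all x ≥ 0: β̃(x) j β̃(x)* = 0 and β̃′(x) j β̃(x)* = β′(x) j β(x)*. -/
open Matrix

section MatrixCalculus

variable {k l m n : Type*} {x : ℝ}

theorem hasDerivAt_matrix_conjTranspose_apply {M : ℝ → Matrix k l ℂ} {M' : Matrix k l ℂ}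
    (hM : ∀ i j, HasDerivAt (fun t => M t i j) (M' i j) x) (i : l) (j : k) :
    HasDerivAt (fun t => (M t)ᴴ i j) (M'ᴴ i j) x :=
  (hM j i).star

variable [Fintype l] [Fintype n] [DecidableEq n]

theorem hasDerivAt_matrix_mul_apply {M : ℝ → Matrix k l ℂ} {N : ℝ → Matrix l m ℂ}
    {M' : Matrix k l ℂ} {N' : Matrix l m ℂ}
    (hM : ∀ i j, HasDerivAt (fun t => M t i j) (M' i j) x)
    (hN : ∀ i j, HasDerivAt (fun t => N t i j) (N' i j) x) (i : k) (j : m) :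
    HasDerivAt (fun t => (M t * N t) i j) ((M' * N x + M x * N') i j) x := by
  simp only [Matrix.add_apply, Matrix.mul_apply, ← Finset.sum_add_distrib]
  exact HasDerivAt.fun_sum fun a _ => (hM i a).mul (hN a j)

theorem hasDerivAt_matrix_const_mul_apply (C : Matrix k l ℂ) {N : ℝ → Matrix l m ℂ}
    {N' : Matrix l m ℂ} (hN : ∀ i j, HasDerivAt (fun t => N t i j) (N' i j) x) (i : k) (j : m) :
    HasDerivAt (fun t => (C * N t) i j) ((C * N') i j) x := by
  simpa using hasDerivAt_matrix_mul_apply (M := fun _ => C) (M' := 0)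
    (fun i j => hasDerivAt_const x (C i j)) hN i j

theorem hasDerivAt_matrix_mul_const_apply {M : ℝ → Matrix k l ℂ} {M' : Matrix k l ℂ}
    (hM : ∀ i j, HasDerivAt (fun t => M t i j) (M' i j) x) (C : Matrix l m ℂ) (i : k) (j : m) :
    HasDerivAt (fun t => (M t * C) i j) ((M' * C) i j) x := by
  simpa using hasDerivAt_matrix_mul_apply (N := fun _ => C) (N' := 0)
    hM (fun i j => hasDerivAt_const x (C i j)) i j

attribute [local instance] Matrix.linftyOpNormedRing Matrix.linftyOpNormedAlgebra in
theorem hasDerivAt_matrix_inv_apply {M : ℝ → Matrix n n ℂ} {M' : Matrix n n ℂ}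
    (hM : ∀ i j, HasDerivAt (fun t => M t i j) (M' i j) x) (hx : IsUnit (M x)) (i j : n) :
    HasDerivAt (fun t => (M t)⁻¹ i j) ((-((M x)⁻¹ * M' * (M x)⁻¹)) i j) x := by
  have hd : HasDerivAt M M' x := hasDerivAt_pi.2 fun a => hasDerivAt_pi.2 (hM a)
  obtain ⟨u, hu⟩ := hx
  have hinv := hasFDerivAt_ringInverse (𝕜 := ℝ) u
  rw [hu] at hinv
  have h := hinv.comp_hasDerivAt x hd
  have h' := hasDerivAt_pi.1 (hasDerivAt_pi.1 h i) j
  have hui : (↑u⁻¹ : Matrix n n ℂ) = (M x)⁻¹ := by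
    rw [← hu, Matrix.coe_units_inv]
  simpa [Function.comp_def, ← Matrix.nonsing_inv_eq_ringInverse, hui] using! h'

/-- A matrix function whose entries have vanishing derivative on `[0, ∞)` is constant there. -/
theorem matrix_eq_of_hasDerivAt_zero {M : ℝ → Matrix k m ℂ}
    (hM : ∀ x : ℝ, 0 ≤ x → ∀ i j, HasDerivAt (fun t => M t i j) 0 x) (hx : 0 ≤ x) :
    M x = M 0 := by
  ext i j
  exact constant_of_has_deriv_right_zero
    (fun y hy => (hM y hy.1 i j).continuousAt.continuousWithinAt)
    (fun y hy => (hM y hy.1 i j).hasDerivWithinAt) x ⟨hx, le_rfl⟩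

end MatrixCalculus

section TransferMatrix

variable {m n : Type*} [Fintype m] [Fintype n] [DecidableEq m] [DecidableEq n]
  {J : Matrix m m ℂ} {A S : Matrix n n ℂ} {L : Matrix n m ℂ}

/-- The value at spectral parameter zero of the transfer matrix function. -/
noncomputable def transferAtZero (J : Matrix m m ℂ) (A S : Matrix n n ℂ) (L : Matrix n m ℂ) :
    Matrix m m ℂ :=
  1 - Complex.I • (J * Lᴴ * S⁻¹ * A⁻¹ * L)

/-- The transfer matrix function at spectral parameter zero is `J`-unitary. -/
theorem transferAtZero_mul_conjTranspose (hJ : Jᴴ = J)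
    (hA : IsUnit A) (hS : IsUnit S) (hSS : Sᴴ = S)
    (hid : A * S - S * Aᴴ = Complex.I • (L * J * Lᴴ)) :
    transferAtZero J A S L * J * (transferAtZero J A S L)ᴴ = J := by
  have hA' := (Matrix.isUnit_iff_isUnit_det A).1 hA
  have hS' := (Matrix.isUnit_iff_isUnit_det S).1 hS
  have hAH : Aᴴ * A⁻¹ᴴ = 1 := by
    rw [← Matrix.conjTranspose_mul, Matrix.nonsing_inv_mul _ hA', Matrix.conjTranspose_one]
  have hSi : S⁻¹ᴴ = S⁻¹ := by rw [Matrix.conjTranspose_nonsing_inv, hSS]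
  have key : S⁻¹ * (A⁻¹ * (L * (J * (Lᴴ * (A⁻¹ᴴ * S⁻¹))))) =
      -Complex.I • (A⁻¹ᴴ * S⁻¹ - S⁻¹ * A⁻¹) := by
    have h1 : S⁻¹ * A⁻¹ * (A * S - S * Aᴴ) * (A⁻¹ᴴ * S⁻¹) = A⁻¹ᴴ * S⁻¹ - S⁻¹ * A⁻¹ := by
      calc _ = S⁻¹ * (A⁻¹ * A) * S * (A⁻¹ᴴ * S⁻¹) - S⁻¹ * A⁻¹ * S * (Aᴴ * A⁻¹ᴴ) * S⁻¹ := by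
            noncomm_ring
        _ = S⁻¹ * S * (A⁻¹ᴴ * S⁻¹) - S⁻¹ * A⁻¹ * (S * S⁻¹) := by
            rw [Matrix.nonsing_inv_mul _ hA', hAH]; noncomm_ring
        _ = _ := by
            rw [Matrix.nonsing_inv_mul _ hS', Matrix.mul_nonsing_inv _ hS']; noncomm_ring
    rw [← h1, hid]
    simp [Matrix.mul_assoc, smul_smul]
  have key' (X : Matrix n m ℂ) :
      S⁻¹ * (A⁻¹ * (L * (J * (Lᴴ * (A⁻¹ᴴ * (S⁻¹ * X)))))) =
      -Complex.I • (A⁻¹ᴴ * (S⁻¹ * X) - S⁻¹ * (A⁻¹ * X)) := by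
    simpa [Matrix.mul_assoc, Matrix.sub_mul] using congrArg (· * X) key
  simp only [transferAtZero, Matrix.conjTranspose_sub, Matrix.conjTranspose_one,
    Matrix.conjTranspose_smul, Matrix.conjTranspose_mul, Matrix.conjTranspose_conjTranspose, hSi,
    hJ, Matrix.sub_mul, Matrix.mul_sub, Matrix.one_mul, Matrix.mul_one, Matrix.smul_mul,
    Matrix.mul_smul, Matrix.mul_assoc, key', Complex.star_def, Complex.conj_I, smul_sub,
    smul_neg, smul_smul, Matrix.mul_neg, mul_neg, Complex.I_mul_I, neg_smul, neg_neg, one_smul]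
  module

/-- The logarithmic derivative formula for the transfer matrix function at spectral parameter
zero: the left side is the one given by the product rule. -/
theorem transferAtZero_deriv_eq {H : Matrix m m ℂ} (hJ : Jᴴ = J) (hH : Hᴴ = H)
    (hA : IsUnit A) (hS : IsUnit S)
    (hid : A * S - S * Aᴴ = Complex.I • (L * J * Lᴴ)) :
    -(Complex.I • (J * (((-Complex.I) • (A * L * J * H))ᴴ * (S⁻¹ * (A⁻¹ * L)) +
        Lᴴ * (-(S⁻¹ * (L * J * H * J * Lᴴ) * S⁻¹) * (A⁻¹ * L) +
          S⁻¹ * (A⁻¹ * ((-Complex.I) • (A * L * J * H))))))) =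
      J * (H * J * (Lᴴ * S⁻¹ * L) - Lᴴ * S⁻¹ * L * J * H) * transferAtZero J A S L := by
  have hA' := (Matrix.isUnit_iff_isUnit_det A).1 hA
  have hS' := (Matrix.isUnit_iff_isUnit_det S).1 hS
  have key : Aᴴ * S⁻¹ * A⁻¹ = S⁻¹ - Complex.I • (S⁻¹ * (L * J * Lᴴ) * S⁻¹ * A⁻¹) := by
    have h1 : S⁻¹ * (A * S - S * Aᴴ) * S⁻¹ * A⁻¹ = S⁻¹ - Aᴴ * S⁻¹ * A⁻¹ := by
      calc _ = S⁻¹ * A * (S * S⁻¹) * A⁻¹ - (S⁻¹ * S) * Aᴴ * S⁻¹ * A⁻¹ := by noncomm_ring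
        _ = S⁻¹ * (A * A⁻¹) - Aᴴ * S⁻¹ * A⁻¹ := by
            rw [Matrix.nonsing_inv_mul _ hS', Matrix.mul_nonsing_inv _ hS']; noncomm_ring
        _ = _ := by rw [Matrix.mul_nonsing_inv _ hA', Matrix.mul_one]
    rw [hid] at h1
    simp only [Matrix.mul_smul, Matrix.smul_mul] at h1
    rw [h1, sub_sub_cancel]
  have key' : Aᴴ * (S⁻¹ * (A⁻¹ * L)) =
      S⁻¹ * L - Complex.I • (S⁻¹ * (L * (J * (Lᴴ * (S⁻¹ * (A⁻¹ * L)))))) := by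
    simpa [Matrix.mul_assoc, Matrix.sub_mul] using congrArg (· * L) key
  have hAA (X : Matrix n m ℂ) : A⁻¹ * (A * X) = X := by
    rw [← Matrix.mul_assoc, Matrix.nonsing_inv_mul _ hA', Matrix.one_mul]
  simp only [transferAtZero, Matrix.conjTranspose_neg, Matrix.conjTranspose_smul,
    Matrix.conjTranspose_mul, hJ, hH, Matrix.sub_mul, Matrix.mul_sub, Matrix.mul_add, Matrix.mul_one, Matrix.smul_mul,
    Matrix.mul_smul, Matrix.mul_neg, Matrix.neg_mul, Matrix.mul_assoc, key', hAA,
    Complex.star_def, Complex.conj_I, smul_sub, smul_add, smul_neg, smul_smul, mul_neg,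
    Complex.I_mul_I, neg_smul, neg_neg, one_smul]
  module

theorem hasDerivAt_transferAtZero {H : Matrix m m ℂ} {S : ℝ → Matrix n n ℂ}
    {L : ℝ → Matrix n m ℂ} {x : ℝ} (hJ : Jᴴ = J) (hH : Hᴴ = H)
    (hA : IsUnit A) (hS : IsUnit (S x))
    (hid : A * S x - S x * Aᴴ = Complex.I • (L x * J * (L x)ᴴ))
    (hL' : ∀ i k, HasDerivAt (fun t => L t i k) (((-Complex.I) • (A * L x * J * H)) i k) x)
    (hS' : ∀ i k, HasDerivAt (fun t => S t i k) ((L x * J * H * J * (L x)ᴴ) i k) x) (i k : m) :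
    HasDerivAt (fun t => transferAtZero J A (S t) (L t) i k)
      ((J * (H * J * ((L x)ᴴ * (S x)⁻¹ * L x) - (L x)ᴴ * (S x)⁻¹ * L x * J * H) *
        transferAtZero J A (S x) (L x)) i k) x := by
  rw [← transferAtZero_deriv_eq hJ hH hA hS hid]
  have h := hasDerivAt_matrix_const_mul_apply J (hasDerivAt_matrix_mul_apply
    (hasDerivAt_matrix_conjTranspose_apply hL') (hasDerivAt_matrix_mul_apply
      (hasDerivAt_matrix_inv_apply hS' hS) (hasDerivAt_matrix_const_mul_apply A⁻¹ hL'))) i k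
  simpa only [transferAtZero, Matrix.sub_apply, Matrix.smul_apply, Matrix.neg_apply, smul_eq_mul,
    Matrix.mul_assoc] using (h.const_mul Complex.I).const_sub ((1 : Matrix m m ℂ) i k)

end TransferMatrix

section Propagation

variable {m n : Type*} [Fintype m] {J : Matrix m m ℂ} {H : ℝ → Matrix m m ℂ}
  {S : ℝ → Matrix n n ℂ} {L : ℝ → Matrix n m ℂ}

theorem gbdt_isHermitian (hJ : Jᴴ = J) (hH : ∀ x, (H x)ᴴ = H x) (h0 : (S 0)ᴴ = S 0)
    (hS' : ∀ x : ℝ, 0 ≤ x → ∀ i k, HasDerivAt (fun t => S t i k)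
      ((L x * J * H x * J * (L x)ᴴ) i k) x) {x : ℝ} (hx : 0 ≤ x) :
    (S x)ᴴ = S x := by
  have h := matrix_eq_of_hasDerivAt_zero (M := fun t => (S t)ᴴ - S t) (fun y hy i k => by
    refine ((hasDerivAt_matrix_conjTranspose_apply (hS' y hy) i k).sub
      (hS' y hy i k)).congr_deriv ?_
    simp only [Matrix.conjTranspose_mul, Matrix.conjTranspose_conjTranspose, hJ, hH,
      Matrix.mul_assoc, sub_self]) hx
  simpa only [h0, sub_self, sub_eq_zero] using h

theorem gbdt_operator_identity [Fintype n] {A : Matrix n n ℂ} (hJ : Jᴴ = J)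
    (hH : ∀ x, (H x)ᴴ = H x)
    (h0 : A * S 0 - S 0 * Aᴴ = Complex.I • (L 0 * J * (L 0)ᴴ))
    (hL' : ∀ x : ℝ, 0 ≤ x → ∀ i k, HasDerivAt (fun t => L t i k)
      (((-Complex.I) • (A * L x * J * H x)) i k) x)
    (hS' : ∀ x : ℝ, 0 ≤ x → ∀ i k, HasDerivAt (fun t => S t i k)
      ((L x * J * H x * J * (L x)ᴴ) i k) x) {x : ℝ} (hx : 0 ≤ x) :
    A * S x - S x * Aᴴ = Complex.I • (L x * J * (L x)ᴴ) := by
  have h := matrix_eq_of_hasDerivAt_zero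
    (M := fun t => A * S t - S t * Aᴴ - Complex.I • (L t * J * (L t)ᴴ)) (fun y hy i k => by
      have h1 := hasDerivAt_matrix_const_mul_apply A (hS' y hy) i k
      have h2 := hasDerivAt_matrix_mul_const_apply (hS' y hy) Aᴴ i k
      have h3 := hasDerivAt_matrix_mul_apply (hasDerivAt_matrix_mul_const_apply (hL' y hy) J)
        (hasDerivAt_matrix_conjTranspose_apply (hL' y hy)) i k
      refine ((h1.sub h2).sub (h3.const_mul Complex.I)).congr_deriv ?_
      rw [← smul_eq_mul (a := Complex.I), ← Matrix.smul_apply, ← Matrix.sub_apply,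
        ← Matrix.sub_apply, ← Matrix.zero_apply (α := ℂ) i k]
      refine congrFun (congrFun ?_ i) k
      simp only [Matrix.conjTranspose_neg, Matrix.conjTranspose_smul, Matrix.conjTranspose_mul,
        hJ, hH, Matrix.smul_mul, Matrix.mul_smul, Matrix.neg_mul,
        Matrix.mul_assoc, Complex.star_def, Complex.conj_I, smul_add, smul_neg, smul_smul,
        Complex.I_mul_I, neg_smul, neg_neg, one_smul]
      abel) hx
  simpa only [h0, sub_self, sub_eq_zero] using h

end Propagation

/-- Under the GBDT data with `H(x) = β(x)*β(x)` where `β` is continuously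
differentiable and `β(x) j β(x)* = 0`, with `S(x)` invertible for `x ≥ 0` and `𝒜` invertible,
the transformed `β̃(x) = β(x) w_𝒜(x,0)` satisfies `β̃(x) j β̃(x)* = 0` and
`β̃′(x) j β̃(x)* = β′(x) j β(x)*` for all `x ≥ 0`. -/
theorem gbdt_transformed_beta
    {p n : ℕ} (hp : 0 < p) (hn : 0 < n)
    (j : Matrix (Fin p ⊕ Fin p) (Fin p ⊕ Fin p) ℂ)
    (hj : j = Matrix.fromBlocks 1 0 0 (-1))
    (β β' : ℝ → Matrix (Fin p) (Fin p ⊕ Fin p) ℂ)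
    (hβ' : ∀ x : ℝ, 0 ≤ x → ∀ i k, HasDerivAt (fun t => β t i k) (β' x i k) x)
    (hβ'cont : ∀ i k, ContinuousOn (fun x => β' x i k) (Set.Ici (0 : ℝ)))
    (hβj : ∀ x : ℝ, 0 ≤ x → β x * j * (β x)ᴴ = 0)
    (H : ℝ → Matrix (Fin p ⊕ Fin p) (Fin p ⊕ Fin p) ℂ)
    (hH : ∀ x : ℝ, H x = (β x)ᴴ * β x)
    (𝒜 : Matrix (Fin n) (Fin n) ℂ) (h𝒜 : IsUnit 𝒜)
    (S : ℝ → Matrix (Fin n) (Fin n) ℂ)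
    (Λ : ℝ → Matrix (Fin n) (Fin p ⊕ Fin p) ℂ)
    (hS0sa : (S 0)ᴴ = S 0)
    (hid0 : 𝒜 * S 0 - S 0 * 𝒜ᴴ = Complex.I • (Λ 0 * j * (Λ 0)ᴴ))
    (hΛ : ∀ x : ℝ, 0 ≤ x → ∀ i k, HasDerivAt (fun t => Λ t i k)
      (((-Complex.I) • (𝒜 * Λ x * j * H x)) i k) x)
    (hS : ∀ x : ℝ, 0 ≤ x → ∀ i k, HasDerivAt (fun t => S t i k)
      ((Λ x * j * H x * j * (Λ x)ᴴ) i k) x)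
    (hSinv : ∀ x : ℝ, 0 ≤ x → IsUnit (S x))
    (w𝒜 : ℝ → ℂ → Matrix (Fin p ⊕ Fin p) (Fin p ⊕ Fin p) ℂ)
    (hw𝒜 : ∀ (x : ℝ) (ζ : ℂ), w𝒜 x ζ =
      1 - Complex.I • (j * (Λ x)ᴴ * (S x)⁻¹ * (𝒜 - ζ • 1)⁻¹ * Λ x))
    (βtil : ℝ → Matrix (Fin p) (Fin p ⊕ Fin p) ℂ)
    (hβtil : ∀ x : ℝ, βtil x = β x * w𝒜 x 0) :
    ∀ x : ℝ, 0 ≤ x →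
      βtil x * j * (βtil x)ᴴ = 0 ∧
      (Matrix.of fun i k => deriv (fun t => βtil t i k) x) * j * (βtil x)ᴴ =
        β' x * j * (β x)ᴴ := by
  intro x hx
  have hJ : jᴴ = j := by simp [hj, Matrix.fromBlocks_conjTranspose]
  have hHH (y : ℝ) : (H y)ᴴ = H y := by simp [hH]
  have hid := gbdt_operator_identity hJ hHH hid0 hΛ hS hx
  have hw (t : ℝ) : βtil t = β t * transferAtZero j 𝒜 (S t) (Λ t) := by
    simp [hβtil, hw𝒜, transferAtZero]
  have hwj := transferAtZero_mul_conjTranspose hJ h𝒜 (hSinv x hx)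
    (gbdt_isHermitian hJ hHH hS0sa hS hx) hid
  have hderiv : (Matrix.of fun i k => deriv (fun t => βtil t i k) x) =
      β' x * transferAtZero j 𝒜 (S x) (Λ x) +
        β x * (j * (H x * j * ((Λ x)ᴴ * (S x)⁻¹ * Λ x) - (Λ x)ᴴ * (S x)⁻¹ * Λ x * j * H x) *
          transferAtZero j 𝒜 (S x) (Λ x)) := by
    ext i k
    simp only [hw]
    exact (hasDerivAt_matrix_mul_apply (hβ' x hx) (hasDerivAt_transferAtZero hJ (hHH x) h𝒜
      (hSinv x hx) hid (hΛ x hx) (hS x hx)) i k).deriv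
  rw [hderiv, hw]
  set w := transferAtZero j 𝒜 (S x) (Λ x)
  have hmul (C : Matrix (Fin p) (Fin p ⊕ Fin p) ℂ) :
      C * w * j * (β x * w)ᴴ = C * j * (β x)ᴴ := by
    rw [Matrix.conjTranspose_mul, ← Matrix.mul_assoc, Matrix.mul_assoc C w j,
      Matrix.mul_assoc C (w * j), hwj]
  refine ⟨by rw [hmul, hβj x hx], ?_⟩
  set X := (Λ x)ᴴ * (S x)⁻¹ * Λ x
  have hzero : β x * (j * (H x * j * X - X * j * H x)) * j * (β x)ᴴ = 0 := by
    have hb : β x * (j * (β x)ᴴ) = 0 := by rw [← Matrix.mul_assoc, hβj x hx]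
    have hb' (Y : Matrix (Fin p) (Fin p) ℂ) : β x * (j * ((β x)ᴴ * Y)) = 0 := by
      rw [← Matrix.mul_assoc j, ← Matrix.mul_assoc, hb, Matrix.zero_mul]
    simp only [hH, Matrix.mul_sub, Matrix.sub_mul, Matrix.mul_assoc, hb, hb', Matrix.mul_zero,
      sub_zero]
  rw [Matrix.add_mul, Matrix.add_mul, hmul, ← Matrix.mul_assoc (β x), hmul, hzero, add_zero]
end

section
/- Assume the GBDT data and assume S(x) is invertible for all x ≥ 0. Then the matrix function Λ(x)* S(x)^{−1} satisfies (Λ(x)* S(x)^{−1})′ = i H(x) j Λ(x)* S(x)^{−1} 𝒜 + q̃₀(x)* Λ(x)* S(x)^{−1} for all x ≥ 0, where q̃₀(x) = j Λ(x)* S(x)^{−1} Λ(x) j H(x) − j H(x) j Λ(x)* S(x)^{−1} Λ(x). -/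
open Matrix

/-- Entrywise differentiability of a matrix function of a real variable at a point. -/
def HasEntrywiseDerivAt {l m : Type*} (M : ℝ → Matrix l m ℂ) (M' : Matrix l m ℂ) (x : ℝ) : Prop :=
  ∀ i k, HasDerivAt (fun t => M t i k) (M' i k) x

namespace HasEntrywiseDerivAt

variable {l m p : Type*} {M N : ℝ → Matrix l m ℂ} {M' N' : Matrix l m ℂ} {x : ℝ}

theorem congr_deriv (hM : HasEntrywiseDerivAt M M' x) (h : M' = N') :
    HasEntrywiseDerivAt M N' x := h ▸ hM

theorem const (C : Matrix l m ℂ) (x : ℝ) : HasEntrywiseDerivAt (fun _ => C) 0 x :=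
  fun i k => hasDerivAt_const x (C i k)

theorem sub (hM : HasEntrywiseDerivAt M M' x) (hN : HasEntrywiseDerivAt N N' x) :
    HasEntrywiseDerivAt (fun t => M t - N t) (M' - N') x :=
  fun i k => (hM i k).sub (hN i k)

theorem const_smul (c : ℂ) (hM : HasEntrywiseDerivAt M M' x) :
    HasEntrywiseDerivAt (fun t => c • M t) (c • M') x :=
  fun i k => (hM i k).const_smul c

theorem conjTranspose (hM : HasEntrywiseDerivAt M M' x) :
    HasEntrywiseDerivAt (fun t => (M t)ᴴ) M'ᴴ x :=
  fun i k => (hM k i).star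

theorem mul [Fintype m] {P : ℝ → Matrix m p ℂ} {P' : Matrix m p ℂ}
    (hM : HasEntrywiseDerivAt M M' x) (hP : HasEntrywiseDerivAt P P' x) :
    HasEntrywiseDerivAt (fun t => M t * P t) (M' * P x + M x * P') x := fun i k => by
  simp only [Matrix.mul_apply, Matrix.add_apply, ← Finset.sum_add_distrib]
  exact HasDerivAt.fun_sum fun a _ => (hM i a).mul (hP a k)

section Inverse

open scoped Matrix.Norms.Operator

theorem inv [Fintype l] [DecidableEq l] {M : ℝ → Matrix l l ℂ} {M' : Matrix l l ℂ}
    (hM : HasEntrywiseDerivAt M M' x) (hu : IsUnit (M x)) :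
    HasEntrywiseDerivAt (fun t => (M t)⁻¹) (-((M x)⁻¹ * M' * (M x)⁻¹)) x := by
  obtain ⟨u, hu⟩ := hu
  have hMx : HasDerivAt M M' x := hasDerivAt_pi.2 fun i => hasDerivAt_pi.2 fun k => hM i k
  have hinv := hasFDerivAt_ringInverse (𝕜 := ℝ) u
  rw [hu] at hinv
  have h := hinv.comp_hasDerivAt x hMx
  intro i k
  have hik := hasDerivAt_pi.1 (hasDerivAt_pi.1 h i) k
  simpa [Function.comp_def, ← Matrix.nonsing_inv_eq_ringInverse, ← hu] using hik

end Inverse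

/-- A matrix function on `[0, ∞)` with vanishing derivative is constant. -/
theorem eq_of_zero (hM : ∀ x : ℝ, 0 ≤ x → HasEntrywiseDerivAt M 0 x) {x : ℝ} (hx : 0 ≤ x) :
    M x = M 0 := by
  ext i k
  exact constant_of_has_deriv_right_zero (f := fun t => M t i k)
    (fun t ht => (hM t ht.1 i k).continuousAt.continuousWithinAt)
    (fun t ht => (hM t ht.1 i k).hasDerivWithinAt) x ⟨hx, le_rfl⟩

end HasEntrywiseDerivAt

/-- Under the GBDT data with `S(x)` invertible for all `x ≥ 0`, the matrix
function `Λ(x)* S(x)⁻¹` satisfies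
`(Λ(x)* S(x)⁻¹)′ = i H(x) j Λ(x)* S(x)⁻¹ 𝒜 + q̃₀(x)* Λ(x)* S(x)⁻¹`, where
`q̃₀(x) = j Λ(x)* S(x)⁻¹ Λ(x) j H(x) − j H(x) j Λ(x)* S(x)⁻¹ Λ(x)`. -/
theorem gbdt_generalized_eigenfunction_dual
    {m₁ m₂ n : ℕ} (hm₁ : 0 < m₁) (hm₂ : 0 < m₂) (hn : 0 < n)
    (j : Matrix (Fin m₁ ⊕ Fin m₂) (Fin m₁ ⊕ Fin m₂) ℂ)
    (hj : j = Matrix.fromBlocks 1 0 0 (-1))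
    (H : ℝ → Matrix (Fin m₁ ⊕ Fin m₂) (Fin m₁ ⊕ Fin m₂) ℂ)
    (hHcont : Continuous H)
    (hHsa : ∀ x : ℝ, 0 ≤ x → (H x)ᴴ = H x)
    (𝒜 : Matrix (Fin n) (Fin n) ℂ)
    (S : ℝ → Matrix (Fin n) (Fin n) ℂ)
    (Λ : ℝ → Matrix (Fin n) (Fin m₁ ⊕ Fin m₂) ℂ)
    (hS0sa : (S 0)ᴴ = S 0)
    (hid0 : 𝒜 * S 0 - S 0 * 𝒜ᴴ = Complex.I • (Λ 0 * j * (Λ 0)ᴴ))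
    (hΛ : ∀ x : ℝ, 0 ≤ x → ∀ i k, HasDerivAt (fun t => Λ t i k)
      (((-Complex.I) • (𝒜 * Λ x * j * H x)) i k) x)
    (hS : ∀ x : ℝ, 0 ≤ x → ∀ i k, HasDerivAt (fun t => S t i k)
      ((Λ x * j * H x * j * (Λ x)ᴴ) i k) x)
    (hSinv : ∀ x : ℝ, 0 ≤ x → IsUnit (S x))
    (q₀ : ℝ → Matrix (Fin m₁ ⊕ Fin m₂) (Fin m₁ ⊕ Fin m₂) ℂ)
    (hq₀ : ∀ x : ℝ, q₀ x =
      j * (Λ x)ᴴ * (S x)⁻¹ * Λ x * j * H x - j * H x * j * (Λ x)ᴴ * (S x)⁻¹ * Λ x) :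
    ∀ x : ℝ, 0 ≤ x → ∀ i k, HasDerivAt (fun t => ((Λ t)ᴴ * (S t)⁻¹) i k)
      ((Complex.I • (H x * j * (Λ x)ᴴ * (S x)⁻¹ * 𝒜) + (q₀ x)ᴴ * (Λ x)ᴴ * (S x)⁻¹) i k) x := by
  have hjsa : jᴴ = j := by
    rw [hj, Matrix.fromBlocks_conjTranspose]
    simp
  replace hΛ : ∀ x : ℝ, 0 ≤ x →
      HasEntrywiseDerivAt Λ ((-Complex.I) • (𝒜 * Λ x * j * H x)) x := hΛ
  replace hS : ∀ x : ℝ, 0 ≤ x → HasEntrywiseDerivAt S (Λ x * j * H x * j * (Λ x)ᴴ) x := hS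
  have hΛstar : ∀ x : ℝ, 0 ≤ x →
      HasEntrywiseDerivAt (fun t => (Λ t)ᴴ) (Complex.I • (H x * j * (Λ x)ᴴ * 𝒜ᴴ)) x :=
    fun x hx => (hΛ x hx).conjTranspose.congr_deriv <| by
      simp [Matrix.conjTranspose_smul, Matrix.conjTranspose_mul, hjsa, hHsa x hx, Matrix.mul_assoc]
  have hSsa : ∀ x : ℝ, 0 ≤ x → (S x)ᴴ = S x := fun x hx => by
    have h := HasEntrywiseDerivAt.eq_of_zero (M := fun t => (S t)ᴴ - S t)
      (fun t ht => ((hS t ht).conjTranspose.sub (hS t ht)).congr_deriv <| by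
        simp [Matrix.conjTranspose_mul, hjsa, hHsa t ht, Matrix.mul_assoc]) hx
    simpa [hS0sa, sub_eq_zero] using h
  have hid : ∀ x : ℝ, 0 ≤ x →
      𝒜 * S x - S x * 𝒜ᴴ = Complex.I • (Λ x * j * (Λ x)ᴴ) := fun x hx => by
    have h := HasEntrywiseDerivAt.eq_of_zero
      (M := fun t => 𝒜 * S t - S t * 𝒜ᴴ - Complex.I • (Λ t * j * (Λ t)ᴴ))
      (fun t ht => ((((HasEntrywiseDerivAt.const 𝒜 t).mul (hS t ht)).sub
        ((hS t ht).mul (.const 𝒜ᴴ t))).sub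
        ((((hΛ t ht).mul (.const j t)).mul (hΛstar t ht)).const_smul Complex.I)).congr_deriv <| by
          simp [smul_smul, Matrix.mul_assoc, sub_eq_add_neg]) hx
    simpa [hid0, sub_eq_zero] using h
  intro x hx
  have hdet : IsUnit (S x).det := (Matrix.isUnit_iff_isUnit_det _).1 (hSinv x hx)
  have hcomm : 𝒜ᴴ * (S x)⁻¹ =
      (S x)⁻¹ * 𝒜 - Complex.I • ((S x)⁻¹ * (Λ x * j * (Λ x)ᴴ) * (S x)⁻¹) := by
    have h := congrArg (fun X => (S x)⁻¹ * X * (S x)⁻¹) (hid x hx)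
    simp only [Matrix.mul_sub, Matrix.sub_mul, Matrix.mul_smul, Matrix.smul_mul] at h
    rw [← h, ← Matrix.mul_assoc, Matrix.mul_assoc (_ * 𝒜), Matrix.mul_nonsing_inv _ hdet,
      ← Matrix.mul_assoc, Matrix.nonsing_inv_mul _ hdet]
    simp
  refine ((hΛstar x hx).mul ((hS x hx).inv (hSinv x hx))).congr_deriv ?_
  have hq : (q₀ x)ᴴ = H x * j * (Λ x)ᴴ * (S x)⁻¹ * Λ x * j
      - (Λ x)ᴴ * (S x)⁻¹ * Λ x * j * H x * j := by
    simp [hq₀, Matrix.conjTranspose_mul, Matrix.conjTranspose_nonsing_inv, hSsa x hx, hjsa,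
      hHsa x hx, Matrix.mul_assoc]
  rw [hq, Matrix.smul_mul, Matrix.mul_assoc _ 𝒜ᴴ, hcomm]
  simp only [Matrix.mul_sub, Matrix.sub_mul, Matrix.mul_smul, smul_sub, smul_smul,
    Complex.I_mul_I, Matrix.mul_neg, Matrix.mul_assoc, neg_smul, one_smul]
  abel
end

section
/- Let H : [0,∞) → ℂ^{2p×2p} be continuous with H(x) ≥ 0 (positive semidefinite) for all x, and for λ ∈ ℂ let W(·,λ) be the solution of W′(x,λ) = iλ j H(x) W(x,λ) with W(0,λ) = I_{2p}. Then for every λ in the open upper half-plane ℂ₊ and all 0 ≤ r₁ ≤ r₂: W(r₂,λ)* j W(r₂,λ) ≤ W(r₁,λ)* j W(r₁,λ) ≤ j and j ≤ W(r₁,λ̄)* j W(r₁,λ̄) ≤ W(r₂,λ̄)* j W(r₂,λ̄), where ≤ is the Loewner order on Hermitian matrices. -/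
open Matrix
open scoped ComplexOrder

/-- The product rule for matrix-valued functions, in terms of entries. -/
theorem hasDerivAt_matrix_mul_apply_s15 {l m n : Type*} [Fintype m]
    {A : ℝ → Matrix l m ℂ} {B : ℝ → Matrix m n ℂ} {A' : Matrix l m ℂ} {B' : Matrix m n ℂ} {x : ℝ}
    (hA : ∀ i k, HasDerivAt (fun t => A t i k) (A' i k) x)
    (hB : ∀ i k, HasDerivAt (fun t => B t i k) (B' i k) x) (i : l) (k : n) :
    HasDerivAt (fun t => (A t * B t) i k) ((A' * B x + A x * B') i k) x := by
  simp only [Matrix.mul_apply, Matrix.add_apply, ← Finset.sum_add_distrib]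
  exact HasDerivAt.fun_sum fun q _ => (hA i q).fun_mul (hB q k)

/-- A differentiable function on `[0, ∞)` with Hermitian values and positive semidefinite
derivative is monotone in the Loewner order. -/
theorem posSemidef_sub_of_hasDerivAt {n : Type*} [Fintype n] {M D : ℝ → Matrix n n ℂ}
    (hM : ∀ t, (M t).IsHermitian)
    (hderiv : ∀ t, 0 ≤ t → ∀ i k, HasDerivAt (fun s => M s i k) (D t i k) t)
    (hD : ∀ t, 0 ≤ t → (D t).PosSemidef) {a b : ℝ} (ha : 0 ≤ a) (hab : a ≤ b) :
    (M b - M a).PosSemidef := by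
  refine .of_dotProduct_mulVec_nonneg ((hM b).sub (hM a)) fun v => ?_
  rw [Complex.nonneg_iff]
  refine ⟨?_, (((hM b).sub (hM a)).im_star_dotProduct_mulVec_self v).symm⟩
  have hform (t : ℝ) (ht : 0 ≤ t) : HasDerivAt (fun s => (star v ⬝ᵥ M s *ᵥ v).re)
      (star v ⬝ᵥ D t *ᵥ v).re t := by
    refine Complex.reCLM.hasFDerivAt.comp_hasDerivAt t ?_
    simp only [dotProduct, mulVec]
    exact HasDerivAt.fun_sum fun i _ => HasDerivAt.const_mul _ <|
      HasDerivAt.fun_sum fun k _ => (hderiv t ht i k).mul_const _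
  have hmono : MonotoneOn (fun s => (star v ⬝ᵥ M s *ᵥ v).re) (Set.Ici 0) := by
    refine monotoneOn_of_deriv_nonneg (convex_Ici 0)
      (fun t ht => (hform t ht).continuousAt.continuousWithinAt)
      (fun t ht => (hform t (interior_subset ht)).differentiableAt.differentiableWithinAt)
      fun t ht => ?_
    rw [(hform t (interior_subset ht)).deriv]
    exact (hD t (interior_subset ht)).re_dotProduct_nonneg v
  have h := hmono (Set.mem_Ici.2 ha) (Set.mem_Ici.2 (ha.trans hab)) hab
  simpa [Matrix.sub_mulVec, dotProduct_sub] using h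

/-- Along a solution of `W' = iλ j H W` with `j` a Hermitian involution,
`(W* j W)' = -2 (Im λ) W* H W`. -/
theorem hasDerivAt_conjTranspose_mul_mul_apply {n : Type*} [Fintype n] [DecidableEq n]
    {j : Matrix n n ℂ} (hj : j.IsHermitian) (hjj : j * j = 1) {H : Matrix n n ℂ}
    (hH : H.IsHermitian) {W : ℝ → Matrix n n ℂ} {lam : ℂ} {x : ℝ}
    (hW : ∀ i k, HasDerivAt (fun t => W t i k) (((Complex.I * lam) • (j * H * W x)) i k) x)
    (i k : n) :
    HasDerivAt (fun t => ((W t)ᴴ * j * W t) i k)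
      (((-2 * lam.im) • ((W x)ᴴ * H * W x)) i k) x := by
  have hconj (i k : n) : HasDerivAt (fun t => (W t)ᴴ i k)
      (((Complex.I * lam) • (j * H * W x))ᴴ i k) x := (hW k i).star
  have hleft (i k : n) := hasDerivAt_matrix_mul_apply_s15 hconj
    (B := fun _ => j) (B' := 0) (fun i k => hasDerivAt_const x (j i k)) i k
  have h := hasDerivAt_matrix_mul_apply_s15 hleft hW i k
  have hcoef : star (Complex.I * lam) + Complex.I * lam = ((-2 * lam.im : ℝ) : ℂ) := by
    apply Complex.ext <;> simp
    ring
  have hD : (((Complex.I * lam) • (j * H * W x))ᴴ * j + (W x)ᴴ * 0) * W x +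
      (W x)ᴴ * j * ((Complex.I * lam) • (j * H * W x)) =
      (-2 * lam.im) • ((W x)ᴴ * H * W x) := by
    have h₁ : (W x)ᴴ * (H * j) * j * W x = (W x)ᴴ * H * W x := by
      rw [Matrix.mul_assoc (W x)ᴴ, Matrix.mul_assoc H, hjj, Matrix.mul_one]
    have h₂ : (W x)ᴴ * j * (j * H * W x) = (W x)ᴴ * H * W x := by
      rw [Matrix.mul_assoc j H, ← Matrix.mul_assoc, Matrix.mul_assoc _ j j, hjj, Matrix.mul_one,
        Matrix.mul_assoc]
    rw [Matrix.mul_zero, add_zero, conjTranspose_smul, conjTranspose_mul, conjTranspose_mul,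
      hj.eq, hH.eq, Matrix.smul_mul, Matrix.smul_mul, Matrix.mul_smul, h₁, h₂, ← add_smul, hcoef]
    ext
    simp
  rwa [hD] at h

/-- For the canonical system `W′(x,λ) = iλ j H(x) W(x,λ)`, `W(0,λ) = I_{2p}` with
`H(x) ≥ 0`: for `λ ∈ ℂ₊` and `0 ≤ r₁ ≤ r₂`,
`W(r₂,λ)* j W(r₂,λ) ≤ W(r₁,λ)* j W(r₁,λ) ≤ j` and
`j ≤ W(r₁,λ̄)* j W(r₁,λ̄) ≤ W(r₂,λ̄)* j W(r₂,λ̄)` in the Loewner order. -/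
theorem canonical_system_weyl_monotonicity
    {p : ℕ} (hp : 0 < p)
    (j : Matrix (Fin p ⊕ Fin p) (Fin p ⊕ Fin p) ℂ)
    (hj : j = Matrix.fromBlocks 1 0 0 (-1))
    (H : ℝ → Matrix (Fin p ⊕ Fin p) (Fin p ⊕ Fin p) ℂ)
    (hHcont : Continuous H)
    (hHpsd : ∀ x : ℝ, 0 ≤ x → (H x).PosSemidef)
    (W : ℝ → ℂ → Matrix (Fin p ⊕ Fin p) (Fin p ⊕ Fin p) ℂ)
    (hW0 : ∀ lam : ℂ, W 0 lam = 1)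
    (hWode : ∀ lam : ℂ, ∀ x : ℝ, 0 ≤ x → ∀ i k, HasDerivAt (fun t => W t lam i k)
      (((Complex.I * lam) • (j * H x * W x lam)) i k) x) :
    ∀ lam : ℂ, 0 < lam.im → ∀ r₁ r₂ : ℝ, 0 ≤ r₁ → r₁ ≤ r₂ →
      ((W r₁ lam)ᴴ * j * W r₁ lam - (W r₂ lam)ᴴ * j * W r₂ lam).PosSemidef ∧
      (j - (W r₁ lam)ᴴ * j * W r₁ lam).PosSemidef ∧
      ((W r₁ ((starRingEnd ℂ) lam))ᴴ * j * W r₁ ((starRingEnd ℂ) lam) - j).PosSemidef ∧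
      ((W r₂ ((starRingEnd ℂ) lam))ᴴ * j * W r₂ ((starRingEnd ℂ) lam) -
        (W r₁ ((starRingEnd ℂ) lam))ᴴ * j * W r₁ ((starRingEnd ℂ) lam)).PosSemidef := by
  intro lam hlam r₁ r₂ hr₁ hr
  have hjH : j.IsHermitian := by
    rw [hj]
    simp [Matrix.IsHermitian, Matrix.fromBlocks_conjTranspose]
  have hjj : j * j = 1 := by
    rw [hj]
    simp [Matrix.fromBlocks_multiply]
  have hherm (mu : ℂ) (t : ℝ) : ((W t mu)ᴴ * j * W t mu).IsHermitian :=
    isHermitian_conjTranspose_mul_mul _ hjH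
  have hzero (mu : ℂ) : (W 0 mu)ᴴ * j * W 0 mu = j := by simp [hW0]
  have hderiv (mu : ℂ) (t : ℝ) (ht : 0 ≤ t) := hasDerivAt_conjTranspose_mul_mul_apply hjH hjj
    (hHpsd t ht).isHermitian (hWode mu t ht)
  have hpsd (mu : ℂ) (c : ℝ) (hc : 0 ≤ c) (t : ℝ) (ht : 0 ≤ t) :
      (c • ((W t mu)ᴴ * H t * W t mu)).PosSemidef :=
    ((hHpsd t ht).conjTranspose_mul_mul_same _).smul hc
  have hdecr {a b : ℝ} (ha : 0 ≤ a) (hab : a ≤ b) :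
      ((W a lam)ᴴ * j * W a lam - (W b lam)ᴴ * j * W b lam).PosSemidef := by
    rw [← neg_sub_neg]
    refine posSemidef_sub_of_hasDerivAt (M := fun t => -((W t lam)ᴴ * j * W t lam))
      (D := fun t => (2 * lam.im) • ((W t lam)ᴴ * H t * W t lam))
      (fun t => (hherm lam t).neg) (fun t ht i k => ?_) (hpsd lam _ (by positivity)) ha hab
    simpa using (hderiv lam t ht i k).fun_neg
  have hincr {a b : ℝ} (ha : 0 ≤ a) (hab : a ≤ b) :=
    posSemidef_sub_of_hasDerivAt (hherm ((starRingEnd ℂ) lam)) (hderiv ((starRingEnd ℂ) lam))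
      (hpsd _ _ (by simp [hlam.le])) ha hab
  refine ⟨hdecr hr₁ hr, ?_, ?_, hincr hr₁ hr⟩
  · simpa only [hzero] using hdecr le_rfl hr₁
  · simpa only [hzero] using hincr le_rfl hr₁
end
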